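/- Let K/k be a cyclic Galois extension of prime degree d with Galois group 𝒢, let n ≥ 1 with d dividing n+1, and suppose 𝒢 acts freely on S = {0,1,…,n} (all orbits have size d). Let Q(K) = P_S(K)/Δ(K^×) be the quotient of the twisted permutation module P_S(K) by the subgroup of constant functions, with the induced 𝒢-action. Then H^1(𝒢, Q(K)) ≅ k^× / N_{K/k}(K^×), the relative Brauer group Br(k|K). -/

import Mathlib

open scoped BigOperators

namespace ArithToric

section H1

variable {G : Type*} [Group G] {Γ : Type*} [CommGroup Γ]

/-- The 1-cocycles of `G` with values in `Γ`, where `G` acts on `Γ` via `ρ`: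
maps `c` with `c (g * h) = c g * ρ g (c h)`. -/
def cocycles (ρ : G →* MulAut Γ) : Subgroup (G → Γ) where
  carrier := {c | ∀ g h, c (g * h) = c g * ρ g (c h)}
  one_mem' := by intro g h; simp
  mul_mem' := by
    intro c c' hc hc' g h
    simp only [Pi.mul_apply, hc g h, hc' g h, map_mul]
    exact mul_mul_mul_comm _ _ _ _
  inv_mem' := by
    intro c hc g h
    simp [Pi.inv_apply, hc g h, mul_inv, map_inv, mul_comm]

/-- The 1-coboundaries: maps of the form `g ↦ b⁻¹ * ρ g b`. -/
def coboundaries (ρ : G →* MulAut Γ) : Subgroup (G → Γ) where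
  carrier := {c | ∃ b : Γ, ∀ g, c g = b⁻¹ * ρ g b}
  one_mem' := ⟨1, by simp⟩
  mul_mem' := by
    rintro c c' ⟨b, hb⟩ ⟨b', hb'⟩
    refine ⟨b * b', fun g => ?_⟩
    simp only [Pi.mul_apply, hb g, hb' g, map_mul, mul_inv]
    exact mul_mul_mul_comm _ _ _ _
  inv_mem' := by
    rintro c ⟨b, hb⟩
    exact ⟨b⁻¹, fun g => by simp [hb g, mul_inv, map_inv, mul_comm]⟩

/-- First group cohomology `H¹(G, Γ)` for the action `ρ`, defined as
1-cocycles modulo 1-coboundaries. -/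
def H1 (ρ : G →* MulAut Γ) :=
  cocycles ρ ⧸ ((coboundaries ρ).subgroupOf (cocycles ρ))

noncomputable instance (ρ : G →* MulAut Γ) : CommGroup (H1 ρ) := by
  unfold H1; infer_instance

end H1


section Perm

variable (k K : Type*) [Field k] [Field K] [Algebra k K]
variable (S : Type*) [MulAction (K ≃ₐ[k] K) S]

/-- The Galois action on the twisted permutation module `P_S(K)`: the group of functions
`S → Kˣ` with Galois group action `(g • f) s = g (f (g⁻¹ • s))`. -/
def permTwist : (K ≃ₐ[k] K) →* MulAut (S → Kˣ) where
  toFun g := MulEquiv.arrowCongr (MulAction.toPerm g) (Units.mapEquiv (g : K ≃* K))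
  map_one' := by
    refine MulEquiv.ext fun f => ?_
    funext s
    refine Units.ext ?_
    show (1 : K ≃ₐ[k] K) ((f ((MulAction.toPerm (1 : K ≃ₐ[k] K)).symm s) : Kˣ) : K) =
      ((f s : Kˣ) : K)
    simp
  map_mul' := fun g h => by
    refine MulEquiv.ext fun f => ?_
    funext s
    refine Units.ext ?_
    show (g * h : K ≃ₐ[k] K) ((f ((MulAction.toPerm (g * h : K ≃ₐ[k] K)).symm s) : Kˣ) : K) = _
    have h1 : (MulAction.toPerm (g * h : K ≃ₐ[k] K)).symm s = h⁻¹ • g⁻¹ • s := by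
      simp [mul_smul]
    rw [h1]
    rfl

lemma permTwist_apply (g : K ≃ₐ[k] K) (f : S → Kˣ) (s : S) :
    ((permTwist k K S g f s : Kˣ) : K) = g (f (g⁻¹ • s)) := rfl

end Perm

section QuotConst

variable (k K : Type*) [Field k] [Field K] [Algebra k K]
variable (S : Type*) [MulAction (K ≃ₐ[k] K) S]

/-- The subgroup `Δ(K^×)` of constant functions in `P_S(K)`. -/
def constSubgroup : Subgroup (S → Kˣ) :=
  MonoidHom.range { toFun := fun (u : Kˣ) (_ : S) => u,
                    map_one' := rfl, map_mul' := fun _ _ => rfl }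

lemma map_constSubgroup (g : K ≃ₐ[k] K) :
    (constSubgroup K S).map (permTwist k K S g : (S → Kˣ) →* (S → Kˣ)) = constSubgroup K S := by
  ext f
  constructor
  · rintro ⟨c, ⟨u, rfl⟩, rfl⟩
    exact ⟨Units.mapEquiv (g : K ≃* K) u, rfl⟩
  · rintro ⟨u, rfl⟩
    exact ⟨_, ⟨Units.mapEquiv (g : K ≃* K).symm u, rfl⟩,
      funext fun s => Units.ext (by
        show (g : K ≃* K) ((Units.mapEquiv (g : K ≃* K).symm u : Kˣ) : K) = (u : K)
        show (g : K ≃* K) (((g : K ≃* K).symm (u : K))) = (u : K)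
        exact (g : K ≃* K).apply_symm_apply _)⟩

/-- The induced Galois action on the quotient `Q(K) = P_S(K)/Δ(K^×)`. -/
def quotAction : (K ≃ₐ[k] K) →* MulAut ((S → Kˣ) ⧸ constSubgroup K S) where
  toFun g := QuotientGroup.congr _ _ (permTwist k K S g) (map_constSubgroup k K S g)
  map_one' := by
    refine MulEquiv.ext fun q => ?_
    induction q using QuotientGroup.induction_on with
    | H f =>
      show QuotientGroup.mk (permTwist k K S 1 f) = _
      rw [map_one]
      rfl
  map_mul' := fun g h => by
    refine MulEquiv.ext fun q => ?_
    induction q using QuotientGroup.induction_on with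
    | H f =>
      show QuotientGroup.mk (permTwist k K S (g * h) f) = _
      rw [map_mul]
      rfl

end QuotConst

section Helpers

variable {G : Type*} [Group G] {Γ : Type*} [CommGroup Γ]

lemma cocycle_one {ρ : G →* MulAut Γ} {c : G → Γ} (hc : ∀ g h, c (g * h) = c g * ρ g (c h)) :
    c 1 = 1 := by
  have := hc 1 1
  simpa using this

lemma norm_cocycle [Fintype G] {ρ : G →* MulAut Γ} {c : G → Γ}
    (hc : ∀ g h, c (g * h) = c g * ρ g (c h)) (ξ : G) : ∏ g, ρ g (c ξ) = 1 := by
  have h : ∀ g, ρ g (c ξ) = c (g * ξ) / c g := fun g => by rw [hc]; simp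
  simp only [h, Finset.prod_div_distrib]
  rw [div_eq_one]
  exact Fintype.prod_equiv (Equiv.mulRight ξ) _ _ (fun _ => rfl)

lemma cocycle_ext {ρ : G →* MulAut Γ} {c c' : G → Γ}
    (hc : ∀ g h, c (g * h) = c g * ρ g (c h)) (hc' : ∀ g h, c' (g * h) = c' g * ρ g (c' h))
    {ξ : G} (hξ : ∀ g, g ∈ Subgroup.zpowers ξ) (h : c ξ = c' ξ) (g : G) : c g = c' g := by
  let H : Subgroup G :=
    { carrier := {g | c g = c' g}
      one_mem' := by simp [cocycle_one hc, cocycle_one hc']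
      mul_mem' := by
        intro a b ha hb
        simp only [Set.mem_ofPred_eq] at *
        rw [hc, hc', ha, hb]
      inv_mem' := by
        intro a ha
        simp only [Set.mem_ofPred_eq] at *
        have h1 := hc a⁻¹ a
        have h2 := hc' a⁻¹ a
        rw [inv_mul_cancel, cocycle_one hc] at h1
        rw [inv_mul_cancel, cocycle_one hc'] at h2
        rw [← ha] at h2
        exact mul_right_cancel (h1.symm.trans h2) }
  have : Subgroup.zpowers ξ ≤ H := by
    rw [Subgroup.zpowers_le]; exact h
  exact this (hξ g)

lemma exists_cocycle [Fintype G] (ρ : G →* MulAut Γ) {ξ : G}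
    (hξ : ∀ g, g ∈ Subgroup.zpowers ξ) (q : Γ) (hq : ∏ g, ρ g q = 1) :
    ∃ c : G → Γ, (∀ g h, c (g * h) = c g * ρ g (c h)) ∧ c ξ = q := by
  classical
  let x : Γ ⋊[ρ] G := ⟨q, ξ⟩
  have hx : ∀ i : ℕ, x ^ i = ⟨∏ j ∈ Finset.range i, ρ (ξ ^ j) q, ξ ^ i⟩ := by
    intro i
    induction i with
    | zero => ext <;> simp
    | succ i ih =>
      rw [pow_succ, ih]
      ext
      · rw [SemidirectProduct.mul_left, Finset.prod_range_succ]
      · rw [SemidirectProduct.mul_right, pow_succ]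
  have hord : orderOf x ∣ orderOf ξ := by
    rw [orderOf_dvd_iff_pow_eq_one, hx]
    ext
    · rw [SemidirectProduct.one_left, ← hq, ← IsCyclic.image_range_orderOf hξ,
        Finset.prod_image]
      intro a ha b hb hab
      simp at ha hb
      exact pow_injOn_Iio_orderOf ha hb hab
    · simp [pow_orderOf_eq_one]
  let F : G →* Γ ⋊[ρ] G := monoidHomOfForallMemZpowers hξ hord
  have hF : F ξ = x := monoidHomOfForallMemZpowers_apply_gen hξ hord
  have hr : ∀ g, (F g).right = g := by
    intro g
    obtain ⟨i, rfl⟩ := Subgroup.mem_zpowers_iff.1 (hξ g)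
    rw [map_zpow, hF, ← SemidirectProduct.rightHom_eq_right, map_zpow]
    rfl
  refine ⟨fun g => (F g).left, fun g h => ?_, by simp [hF, x]⟩
  simp [hr]

lemma norm_mem [Fintype G] (ρ : G →* MulAut Γ) (c : cocycles ρ) (ξ : G) :
    ∏ g, ρ g (c.1 ξ) = 1 := norm_cocycle c.2 ξ

/-- The projection from cocycles to `H1`. -/
def toH1 (ρ : G →* MulAut Γ) : cocycles ρ →* H1 ρ :=
  QuotientGroup.mk' ((coboundaries ρ).subgroupOf (cocycles ρ))

lemma toH1_surjective (ρ : G →* MulAut Γ) : Function.Surjective (toH1 ρ) :=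
  QuotientGroup.mk'_surjective _

lemma toH1_eq_one (ρ : G →* MulAut Γ) (c : cocycles ρ) :
    toH1 ρ c = 1 ↔ c.1 ∈ coboundaries ρ :=
  (QuotientGroup.eq_one_iff _).trans Subgroup.mem_subgroupOf

end Helpers

section Free

variable {G : Type*} [Group G] {S : Type*} [MulAction G S]

lemma exists_equivariant (hfree : ∀ g : G, g ≠ 1 → ∀ x : S, g • x ≠ x) :
    ∃ τ : S → G, ∀ g s, τ (g • s) = g * τ s := by
  have h : ∀ s : S, ∃ g : G, s = g • (Quotient.out (Quotient.mk (MulAction.orbitRel G S) s)) := by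
    intro s
    have := Quotient.mk_out (s := MulAction.orbitRel G S) s
    obtain ⟨g, hg⟩ := (MulAction.orbitRel G S).symm this
    exact ⟨g, hg.symm⟩
  choose τ hτ using h
  refine ⟨τ, fun g s => ?_⟩
  have h1 := hτ (g • s)
  have h2 : (Quotient.mk (MulAction.orbitRel G S) (g • s)) = Quotient.mk _ s :=
    Quotient.sound ⟨g, rfl⟩
  rw [h2] at h1
  have h3 := hτ s
  set t := Quotient.out (Quotient.mk (MulAction.orbitRel G S) s)
  by_contra hne
  refine hfree ((g * τ s)⁻¹ * τ (g • s)) ?_ t ?_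
  · intro h; exact hne (inv_mul_eq_one.1 h).symm
  · rw [mul_smul, ← h1, mul_inv_rev, mul_smul, inv_smul_smul, inv_smul_eq_iff]
    exact h3

end Free

section Main

variable {k K : Type*} [Field k] [Field K] [Algebra k K]
variable {S : Type*} [MulAction (K ≃ₐ[k] K) S]

lemma permTwist_apply' (g : K ≃ₐ[k] K) (f : S → Kˣ) (s : S) :
    permTwist k K S g f s = Units.mapEquiv (g : K ≃* K) (f (g⁻¹ • s)) := rfl

lemma perm_trivial {τ : S → (K ≃ₐ[k] K)} (hτ : ∀ g s, τ (g • s) = g * τ s)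
    {c : (K ≃ₐ[k] K) → (S → Kˣ)} (hc : ∀ g h, c (g * h) = c g * permTwist k K S g (c h)) :
    ∃ b : S → Kˣ, ∀ g, c g = b⁻¹ * permTwist k K S g b := by
  refine ⟨fun s => (c (τ s) s)⁻¹, fun g => ?_⟩
  funext s
  have := congrFun (hc g (g⁻¹ * τ s)) s
  rw [mul_inv_cancel_left, Pi.mul_apply, permTwist_apply'] at this
  simp only [Pi.mul_apply, Pi.inv_apply, inv_inv, permTwist_apply', hτ, map_inv]
  rw [this]; simp

lemma exists_norm_eq [Fintype (K ≃ₐ[k] K)] {τ : S → (K ≃ₐ[k] K)}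
    (hτ : ∀ g s, τ (g • s) = g * τ s) (a : kˣ) :
    ∃ f : S → Kˣ, ∏ g, permTwist k K S g f = fun _ => Units.map (algebraMap k K : k →* K) a := by
  classical
  refine ⟨fun s => if τ s = 1 then Units.map (algebraMap k K : k →* K) a else 1, ?_⟩
  funext s
  rw [Finset.prod_apply, Finset.prod_eq_single (τ s)]
  · rw [permTwist_apply']
    ext
    simp only [hτ, inv_mul_cancel, if_true]
    exact (τ s).commutes a
  · intro g _ hg
    rw [permTwist_apply', hτ, if_neg, map_one]
    intro h; exact hg (inv_mul_eq_one.1 h)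
  · simp

lemma norm_const [FiniteDimensional k K] [IsGalois k K] (u : Kˣ) :
    ∏ g, permTwist k K S g (fun _ => u) =
      fun _ => Units.map (algebraMap k K : k →* K) (Units.map (Algebra.norm k : K →* k) u) := by
  funext s
  ext
  rw [Finset.prod_apply, Units.coe_prod]
  simp only [Units.coe_map, MonoidHom.coe_coe]
  exact (Algebra.norm_eq_prod_automorphisms k (u : K)).symm

/-- The triples linking a cocycle, a lift of its value at `ξ`, and the norm of that lift. -/
def linkGroup [Fintype (K ≃ₐ[k] K)] (ξ : K ≃ₐ[k] K) :
    Subgroup ((cocycles (Γ := (S → Kˣ) ⧸ constSubgroup K S) (quotAction k K S)) × (S → Kˣ) × kˣ) where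
  carrier := {x | (x.2.1 : (S → Kˣ) ⧸ constSubgroup K S) = x.1.1 ξ ∧
    ∏ g, permTwist k K S g x.2.1 = fun _ => Units.map (algebraMap k K : k →* K) x.2.2}
  one_mem' := ⟨rfl, by simp; rfl⟩
  mul_mem' := by
    rintro x y ⟨h1, h2⟩ ⟨h3, h4⟩
    refine ⟨?_, ?_⟩
    · show (x.2.1 : (S → Kˣ) ⧸ constSubgroup K S) * (y.2.1 : (S → Kˣ) ⧸ constSubgroup K S) = _
      rw [h1, h3]; rfl
    · simp only [Prod.snd_mul, Prod.fst_mul, map_mul, Finset.prod_mul_distrib, h2, h4]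
      rfl
  inv_mem' := by
    rintro x ⟨h1, h2⟩
    refine ⟨?_, ?_⟩
    · show (x.2.1 : (S → Kˣ) ⧸ constSubgroup K S)⁻¹ = _
      rw [h1]; rfl
    · simp only [Prod.snd_inv, Prod.fst_inv, map_inv, Finset.prod_inv_distrib, h2]
      rfl

lemma quot_mk (g : K ≃ₐ[k] K) (f : S → Kˣ) :
    quotAction k K S g (f : (S → Kˣ) ⧸ constSubgroup K S) =
      ((permTwist k K S g f : S → Kˣ) : (S → Kˣ) ⧸ constSubgroup K S) := rfl

lemma coboundary_cocycle {G : Type*} [Group G] {Γ : Type*} [CommGroup Γ] (ρ : G →* MulAut Γ)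
    (b : Γ) (g h : G) : b⁻¹ * ρ (g * h) b = (b⁻¹ * ρ g b) * ρ g (b⁻¹ * ρ h b) := by
  simp [mul_assoc]

lemma norm_coboundary {G : Type*} [Group G] [Fintype G] {Γ : Type*} [CommGroup Γ]
    (ρ : G →* MulAut Γ) (b : Γ) (ξ : G) : ∏ g, ρ g (b⁻¹ * ρ ξ b) = 1 :=
  norm_cocycle (c := fun g => b⁻¹ * ρ g b) (coboundary_cocycle ρ b) ξ

lemma prod_mk {ι A : Type*} [Fintype ι] [CommGroup A] (N : Subgroup A) (F : ι → A) :
    ∏ i, (F i : A ⧸ N) = ((∏ i, F i : A) : A ⧸ N) :=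
  (map_prod (QuotientGroup.mk' N) F Finset.univ).symm

lemma prod_quot [Fintype (K ≃ₐ[k] K)] (f : S → Kˣ) :
    ∏ g, quotAction k K S g (f : (S → Kˣ) ⧸ constSubgroup K S) =
      ((∏ g, permTwist k K S g f : S → Kˣ) : (S → Kˣ) ⧸ constSubgroup K S) :=
  prod_mk (constSubgroup K S) _

lemma link_surj₂ [Fintype (K ≃ₐ[k] K)] {ξ : K ≃ₐ[k] K}
    (hξ : ∀ g, g ∈ Subgroup.zpowers ξ)
    {τ : S → (K ≃ₐ[k] K)} (hτ : ∀ g s, τ (g • s) = g * τ s) (a : kˣ) :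
    ∃ x ∈ linkGroup (k := k) (K := K) (S := S) ξ, x.2.2 = a := by
  obtain ⟨f, hf⟩ := exists_norm_eq hτ a
  have hN := prod_quot (k := k) f
  rw [hf] at hN
  have hN' := hN.trans ((QuotientGroup.eq_one_iff _).2 ⟨_, rfl⟩)
  obtain ⟨c, hc, hcξ⟩ := exists_cocycle
    (Γ := (S → Kˣ) ⧸ constSubgroup K S) (quotAction k K S) hξ _ hN'
  exact ⟨(⟨c, hc⟩, f, a), ⟨hcξ.symm, hf⟩, rfl⟩

lemma link_surj [FiniteDimensional k K] [IsGalois k K] [Nonempty S] (ξ : K ≃ₐ[k] K)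
    (c : cocycles (Γ := (S → Kˣ) ⧸ constSubgroup K S) (quotAction k K S)) :
    ∃ x ∈ linkGroup (k := k) (K := K) (S := S) ξ, x.1 = c := by
  obtain ⟨f, hf⟩ := QuotientGroup.mk_surjective (c.1 ξ)
  have hN := norm_mem _ c ξ
  rw [← hf] at hN
  have hN' : ((∏ g, permTwist k K S g f : S → Kˣ) : (S → Kˣ) ⧸ constSubgroup K S) = 1 := by
    rw [← hN]
    exact (prod_quot f).symm
  obtain ⟨u, hu⟩ := (QuotientGroup.eq_one_iff _).1 hN'
  have hu : (fun _ => u) = ∏ g, permTwist k K S g f := hu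
  obtain ⟨s⟩ := ‹Nonempty S›
  have hfix : ∀ h : K ≃ₐ[k] K, h (u : K) = u := by
    intro h
    have h1 : permTwist k K S h (fun _ => u) = fun _ => u := by
      rw [hu, map_prod]
      refine Fintype.prod_equiv (Equiv.mulLeft h) _ _ fun g => ?_
      simp [map_mul]
    have := congrFun h1 s
    rw [permTwist_apply'] at this
    exact congrArg Units.val this
  obtain ⟨a, ha⟩ := (IsGalois.mem_range_algebraMap_iff_fixed (F := k) (u : K)).2 hfix
  have ha0 : a ≠ 0 := by
    rintro rfl
    simp at ha
    exact u.ne_zero ha.symm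
  refine ⟨(c, f, Units.mk0 a ha0), ⟨hf, ?_⟩, rfl⟩
  rw [← hu]
  funext _
  ext
  exact ha.symm

lemma link_ker [FiniteDimensional k K] [IsGalois k K] [Nonempty S] {ξ : K ≃ₐ[k] K}
    (hξ : ∀ g, g ∈ Subgroup.zpowers ξ)
    {τ : S → (K ≃ₐ[k] K)} (hτ : ∀ g s, τ (g • s) = g * τ s)
    {x} (hx : x ∈ linkGroup (k := k) (K := K) (S := S) ξ) :
    x.1.1 ∈ coboundaries (Γ := (S → Kˣ) ⧸ constSubgroup K S) (quotAction k K S) ↔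
      x.2.2 ∈ (Units.map (Algebra.norm k : K →* k)).range := by
  obtain ⟨c, f, a⟩ := x
  obtain ⟨h1, h2⟩ := hx
  simp only at h1 h2 ⊢
  constructor
  · rintro ⟨b, hb⟩
    obtain ⟨β, rfl⟩ := QuotientGroup.mk_surjective b
    have h3 := hb ξ
    rw [← h1, quot_mk] at h3
    have h3 : ((β⁻¹ * permTwist k K S ξ β : S → Kˣ) : (S → Kˣ) ⧸ constSubgroup K S) = f := h3.symm
    obtain ⟨u, hu⟩ := QuotientGroup.eq.1 h3
    have hu : (fun _ => u) = (β⁻¹ * permTwist k K S ξ β)⁻¹ * f := hu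
    have hf : f = (β⁻¹ * permTwist k K S ξ β) * (fun _ => u) := by rw [hu, mul_inv_cancel_left]
    refine ⟨u, ?_⟩
    have h4 : ∏ g, permTwist k K S g f = ∏ g, permTwist k K S g (fun _ => u) := by
      rw [hf]
      simp only [map_mul (permTwist k K S _) (β⁻¹ * permTwist k K S ξ β), Finset.prod_mul_distrib]
      rw [norm_coboundary, one_mul]
    rw [h2, norm_const] at h4
    obtain ⟨s⟩ := ‹Nonempty S›
    exact (Units.map_injective (f := (algebraMap k K : k →* K)) (algebraMap k K).injective
      (congrFun h4 s)).symm
  · rintro ⟨u, rfl⟩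
    have h3 : ∏ g, permTwist k K S g (f * (fun _ => u)⁻¹) = 1 := by
      simp only [map_mul (permTwist k K S _) f, map_inv, Finset.prod_mul_distrib,
        Finset.prod_inv_distrib]
      rw [h2, norm_const, mul_inv_cancel]
    obtain ⟨e, he, heξ⟩ := exists_cocycle (permTwist k K S) hξ _ h3
    obtain ⟨b, hb⟩ := perm_trivial hτ he
    refine ⟨(b : (S → Kˣ) ⧸ constSubgroup K S), cocycle_ext (Γ := (S → Kˣ) ⧸ constSubgroup K S) c.2 (coboundary_cocycle _ _) hξ ?_⟩
    rw [← h1, quot_mk]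
    show _ = ((b⁻¹ * permTwist k K S ξ b : S → Kˣ) : (S → Kˣ) ⧸ constSubgroup K S)
    rw [← hb, heξ]
    refine QuotientGroup.eq.2 ⟨u⁻¹, ?_⟩
    rw [inv_mul_cancel_left]
    rfl

lemma main_general [FiniteDimensional k K] [IsGalois k K] [Nonempty S] {ξ : K ≃ₐ[k] K}
    (hξ : ∀ g, g ∈ Subgroup.zpowers ξ)
    {τ : S → (K ≃ₐ[k] K)} (hτ : ∀ g s, τ (g • s) = g * τ s) :
    Nonempty ((@H1 _ _ _ (QuotientGroup.Quotient.commGroup _) (quotAction k K S)) ≃*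
      (kˣ ⧸ (Units.map (Algebra.norm k : K →* k)).range)) := by
  let L := linkGroup (k := k) (K := K) (S := S) ξ
  let Q := toH1 (Γ := (S → Kˣ) ⧸ constSubgroup K S)
    (quotAction k K S)
  let R := QuotientGroup.mk' (Units.map (Algebra.norm k : K →* k)).range
  let φ₁ : L →* _ := (Q.comp (MonoidHom.fst _ _)).comp L.subtype
  let φ₂ : L →* _ := (R.comp ((MonoidHom.snd _ _).comp (MonoidHom.snd _ _))).comp L.subtype
  have hs₁ : Function.Surjective φ₁ := by
    intro q
    obtain ⟨c, rfl⟩ := toH1_surjective _ q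
    obtain ⟨x, hx, rfl⟩ := link_surj ξ c
    exact ⟨⟨x, hx⟩, rfl⟩
  have hs₂ : Function.Surjective φ₂ := by
    intro q
    obtain ⟨a, rfl⟩ := QuotientGroup.mk_surjective q
    obtain ⟨x, hx, rfl⟩ := link_surj₂ hξ hτ a
    exact ⟨⟨x, hx⟩, rfl⟩
  have hker : φ₁.ker = φ₂.ker := by
    ext x
    have h := link_ker hξ hτ x.2
    rw [MonoidHom.mem_ker, MonoidHom.mem_ker]
    refine Iff.trans ?_ (h.trans ?_)
    · exact toH1_eq_one _ _
    · exact (QuotientGroup.eq_one_iff _).symm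
  exact ⟨(QuotientGroup.quotientKerEquivOfSurjective φ₁ hs₁).symm.trans
    ((QuotientGroup.quotientMulEquivOfEq hker).trans
      (QuotientGroup.quotientKerEquivOfSurjective φ₂ hs₂))⟩

end Main

/-- Let `K/k` be a cyclic Galois extension of prime degree `d` with Galois
group `𝒢`, let `n ≥ 1` with `d ∣ n+1`, and suppose `𝒢` acts freely on `S = {0,…,n}`.
Let `Q(K) = P_S(K)/Δ(K^×)` with the induced `𝒢`-action.  Then
`H¹(𝒢, Q(K)) ≅ k^×/N_{K/k}(K^×)`, the relative Brauer group `Br(k|K)`. -/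
theorem h1_projective_space_torus_prime_free
    (k K : Type*) [Field k] [Field K] [Algebra k K] [FiniteDimensional k K] [IsGalois k K]
    (n : ℕ) (hn : 1 ≤ n) [MulAction (K ≃ₐ[k] K) (Fin (n + 1))]
    (d : ℕ) (hp : d.Prime) (hcard : Nat.card (K ≃ₐ[k] K) = d)
    (hcyc : ∃ ξ : K ≃ₐ[k] K, ∀ g : K ≃ₐ[k] K, g ∈ Subgroup.zpowers ξ)
    (hdvd : d ∣ n + 1)
    (hfree : ∀ g : K ≃ₐ[k] K, g ≠ 1 → ∀ x : Fin (n + 1), g • x ≠ x) :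
    Nonempty ((@H1 _ _ _ (QuotientGroup.Quotient.commGroup _) (quotAction k K (Fin (n + 1)))) ≃*
      (kˣ ⧸ (Units.map (Algebra.norm k : K →* k)).range)) := by
  classical
  obtain ⟨ξ, hξ⟩ := hcyc
  obtain ⟨τ, hτ⟩ := exists_equivariant hfree
  exact main_general hξ hτ

end ArithToric
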